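/- Let 𝔹 be the open unit ball in ℂ² and, for 0 < α < π/2, let A_α = {(e^{iφ} cos α, e^{iψ} sin α) : φ, ψ ∈ [0, 2π)} ⊆ ∂𝔹 be the distinguished boundary of the polydisc Δ_α = {(z, w) : |z| < cos α, |w| < sin α}. Then every u ∈ PSH(𝔹) with u ≤ 0 and u* = -∞ on A_α is identically -∞ on 𝔹; in particular A_α is not b-pluripolar. Nevertheless ω*(x, A_α, 𝔹) = 0 for every x ∈ ∂𝔹. -/

import Mathlib

open Complex Metric MeasureTheory Filter Topology Set

noncomputable section

/-- The average of the truncation `max u (-m)` of an `EReal`-valued function `u` over the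
circle of center `c` and radius `r`. -/
noncomputable def truncCircleAvg (u : ℂ → EReal) (c : ℂ) (r : ℝ) (m : ℕ) : ℝ :=
  (2 * Real.pi)⁻¹ *
    ∫ θ in (0:ℝ)..(2 * Real.pi),
      (max (u (c + (r : ℂ) * Complex.exp (θ * Complex.I))) ((-(m : ℝ) : ℝ) : EReal)).toReal

/-- A `[-∞,∞]`-valued function is subharmonic on `U ⊆ ℂ` if it is upper semicontinuous
on `U` and satisfies the sub-mean value inequality on every closed disc contained in `U`
(expressed via averages of truncations from below). -/
def SubharmonicOn (u : ℂ → EReal) (U : Set ℂ) : Prop :=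
  UpperSemicontinuousOn u U ∧
    ∀ c r, 0 < r → Metric.closedBall c r ⊆ U →
      ∀ m : ℕ, u c ≤ ((truncCircleAvg u c r m : ℝ) : EReal)

variable {E : Type*} [NormedAddCommGroup E] [NormedSpace ℂ E]

/-- Plurisubharmonic on `D`: upper semicontinuous on `D`, with values in `[-∞, ∞)`,
whose restriction to every complex line is subharmonic.  (The constant `-∞` is allowed
here; the paper's class `PSH(D)` additionally requires `u ≢ -∞`, see `MemPSH`.) -/
def PshOn (u : E → EReal) (D : Set E) : Prop :=
  UpperSemicontinuousOn u D ∧ (∀ z ∈ D, u z ≠ ⊤) ∧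
    ∀ a b : E, SubharmonicOn (fun ζ : ℂ => u (a + ζ • b)) {ζ : ℂ | a + ζ • b ∈ D}

/-- Membership in the paper's class `PSH(D)`: plurisubharmonic and not identically `-∞`. -/
def MemPSH (u : E → EReal) (D : Set E) : Prop :=
  PshOn u D ∧ ∃ z ∈ D, u z ≠ ⊥

/-- The upper semicontinuous regularization `u*` of `u` on `cl(D)`:
`u*(x) = limsup_{z → x, z ∈ D} u(z)`. -/
noncomputable def uscReg (u : E → EReal) (D : Set E) (x : E) : EReal :=
  Filter.limsup u (nhdsWithin x D)

/-- The boundary relative extremal function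
`ω(z, A, D) = sup { u(z) : u ∈ PSH(D), u ≤ 0 on D, u* ≤ -1 on A }`. -/
noncomputable def bndExt (z : E) (A D : Set E) : EReal :=
  sSup {w : EReal | ∃ u : E → EReal, MemPSH u D ∧ (∀ y ∈ D, u y ≤ 0) ∧
    (∀ x ∈ A, uscReg u D x ≤ -1) ∧ w = u z}

/-- The upper semicontinuous regularization `ω*(·, A, D)` on `cl(D)`. -/
noncomputable def bndExtStar (x : E) (A D : Set E) : EReal :=
  Filter.limsup (fun z => bndExt z A D) (nhdsWithin x D)

/-- A bounded domain: a nonempty connected bounded open set. -/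
def IsBddDomain (D : Set E) : Prop :=
  IsOpen D ∧ IsConnected D ∧ Bornology.IsBounded D

/-- `A ⊆ ∂D` is b-pluripolar if there is `u ∈ PSH(D)`, `u ≤ 0`, `u ≢ -∞`,
with `u* = -∞` on `A`. -/
def BPluripolar (A D : Set E) : Prop :=
  ∃ u : E → EReal, PshOn u D ∧ (∀ z ∈ D, u z ≤ 0) ∧ (∃ z ∈ D, u z ≠ ⊥) ∧
    ∀ x ∈ A, uscReg u D x = ⊥

/-- The b-pluripolar hull `Â` of `A ⊆ ∂D`: all points `z ∈ cl(D)` such that `u*(z) = -∞`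
for every negative `u ∈ PSH(D)`, `u ≢ -∞`, with `u* = -∞` on `A`. -/
def bHull (A D : Set E) : Set E :=
  {z ∈ closure D | ∀ u : E → EReal, PshOn u D → (∀ y ∈ D, u y < 0) →
    (∃ y ∈ D, u y ≠ ⊥) → (∀ x ∈ A, uscReg u D x = ⊥) → uscReg u D z = ⊥}

/-- Weak regularity: for every relatively open `U ⊆ ∂D` one has `ω*(·, U, D) ≤ -1` on `U`. -/
def WeaklyRegular (D : Set E) : Prop :=
  ∀ U W : Set E, IsOpen W → U = W ∩ frontier D → ∀ x ∈ U, bndExtStar x U D ≤ -1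

/-- B-regularity (Sibony): every continuous `f : ∂D → ℝ` extends to a function
plurisubharmonic on `D` and continuous on `cl(D)` with boundary values `f`. -/
def BRegular (D : Set E) : Prop :=
  ∀ f : E → ℝ, ContinuousOn f (frontier D) →
    ∃ F : E → ℝ, ContinuousOn F (closure D) ∧
      PshOn (fun z => ((F z : ℝ) : EReal)) D ∧ ∀ x ∈ frontier D, F x = f x

/-- The extremal function `ω₁(z, K, D)`, defined with continuous-up-to-the-boundary
plurisubharmonic competitors. -/
noncomputable def bndExtCont (z : E) (K D : Set E) : EReal :=
  sSup {w : EReal | ∃ F : E → ℝ, ContinuousOn F (closure D) ∧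
    PshOn (fun y => ((F y : ℝ) : EReal)) D ∧ (∀ y ∈ closure D, F y ≤ 0) ∧
    (∀ x ∈ K, F x ≤ -1) ∧ w = ((F z : ℝ) : EReal)}

end


/-- Angles for which the circle point lies in an open set contain a nondegenerate interval. -/
lemma exists_arc (c : ℂ) (r : ℝ) (V : Set ℂ) (hV : IsOpen V) (θ₀ : ℝ)
    (hq : c + (r : ℂ) * Complex.exp (θ₀ * Complex.I) ∈ V) :
    ∃ a b : ℝ, 0 ≤ a ∧ a < b ∧ b ≤ 2 * Real.pi ∧
      ∀ θ ∈ Set.Icc a b, c + (r : ℂ) * Complex.exp (θ * Complex.I) ∈ V := by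
  have hpi := Real.two_pi_pos
  set θ₁ := toIcoMod hpi 0 θ₀ with hθ₁
  have hmem : θ₁ ∈ Set.Ico 0 (0 + 2 * Real.pi) := toIcoMod_mem_Ico hpi 0 θ₀
  have hexp : Complex.exp (θ₁ * Complex.I) = Complex.exp (θ₀ * Complex.I) := by
    have : θ₁ = θ₀ - toIcoDiv hpi 0 θ₀ • (2 * Real.pi) := rfl
    rw [this, Complex.exp_eq_exp_iff_exists_int]
    refine ⟨-toIcoDiv hpi 0 θ₀, ?_⟩
    simp only [zsmul_eq_mul]
    push_cast
    ring
  have hcont : Continuous fun θ : ℝ => c + (r : ℂ) * Complex.exp (θ * Complex.I) := by fun_prop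
  have hO := hV.preimage hcont
  have h1 : θ₁ ∈ (fun θ : ℝ => c + (r : ℂ) * Complex.exp (θ * Complex.I)) ⁻¹' V := by
    simp only [Set.mem_preimage, hexp]; exact hq
  obtain ⟨ε, hε, hball⟩ := Metric.isOpen_iff.1 hO θ₁ h1
  rw [zero_add] at hmem
  refine ⟨θ₁, min (θ₁ + ε / 2) (2 * Real.pi), hmem.1, lt_min (by linarith) hmem.2,
    min_le_right _ _, ?_⟩
  intro θ hθ
  apply hball
  have := hθ.2.trans (min_le_left _ _)
  rw [Metric.mem_ball, Real.dist_eq, abs_lt]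
  constructor <;> linarith [hθ.1]

/-- Quantitative consequence of the sub-mean value inequality. -/
lemma submean_arc {f : ℂ → EReal} {U : Set ℂ} (hf : SubharmonicOn f U) {c : ℂ} {r : ℝ}
    (hr : 0 < r) (hU : Metric.closedBall c r ⊆ U) {M c' : ℝ} {a b : ℝ}
    (ha : 0 ≤ a) (hab : a < b) (hb : b ≤ 2 * Real.pi) (hcM : c' ≤ M)
    (hM : ∀ ζ ∈ Metric.closedBall c r, f ζ ≤ (M : EReal))
    (hc : ∀ θ ∈ Set.Icc a b, f (c + (r : ℂ) * Complex.exp (θ * Complex.I)) ≤ (c' : EReal)) :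
    f c ≤ ((M - (M - c') * (b - a) / (2 * Real.pi) : ℝ) : EReal) := by
  have hpi := Real.two_pi_pos
  obtain ⟨m, hm⟩ := exists_nat_ge (-c')
  refine (hf.2 c r hr hU m).trans ?_
  rw [EReal.coe_le_coe_iff]
  unfold truncCircleAvg
  set g : ℝ → EReal := fun θ => f (c + (r : ℂ) * Complex.exp (θ * Complex.I)) with hg
  have hin : ∀ θ : ℝ, c + (r : ℂ) * Complex.exp (θ * Complex.I) ∈ Metric.closedBall c r := by
    intro θ
    simp [Complex.norm_exp_ofReal_mul_I, abs_of_pos hr]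
  have husc : UpperSemicontinuous g := by
    intro θ y hy
    have h1 := hf.1 _ (hU (hin θ)) y hy
    have hcont : Continuous fun θ : ℝ => c + (r : ℂ) * Complex.exp (θ * Complex.I) := by fun_prop
    have : Tendsto (fun θ : ℝ => c + (r : ℂ) * Complex.exp (θ * Complex.I)) (𝓝 θ)
        (𝓝[U] (c + (r : ℂ) * Complex.exp (θ * Complex.I))) :=
      tendsto_nhdsWithin_iff.2 ⟨hcont.tendsto θ, Eventually.of_forall fun x => hU (hin x)⟩
    exact this.eventually h1
  have hmeas : Measurable g := husc.measurable
  set h : ℝ → ℝ := fun θ => (max (g θ) ((-(m : ℝ) : ℝ) : EReal)).toReal with hh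
  have hhm : Measurable h := (hmeas.max measurable_const).ereal_toReal
  have key : ∀ (θ t : ℝ), -(m : ℝ) ≤ t → g θ ≤ (t : EReal) → h θ ≤ t := by
    intro θ t ht hgt
    have : max (g θ) ((-(m : ℝ) : ℝ) : EReal) ≤ (t : EReal) :=
      max_le hgt (EReal.coe_le_coe_iff.2 ht)
    have h2 := EReal.toReal_le_toReal this
      (ne_of_gt (lt_of_lt_of_le (EReal.bot_lt_coe _) (le_max_right _ _))) (EReal.coe_ne_top _)
    rwa [EReal.toReal_coe] at h2
  have hlow : ∀ θ, -(m : ℝ) ≤ h θ := by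
    intro θ
    have := EReal.toReal_le_toReal (le_max_right (g θ) ((-(m : ℝ) : ℝ) : EReal))
      (EReal.coe_ne_bot _)
      (ne_of_lt (lt_of_le_of_lt (max_le (hM _ (hin θ))
        (EReal.coe_le_coe_iff.2 (show -(m : ℝ) ≤ M by linarith))) (EReal.coe_lt_top _)))
    rwa [EReal.toReal_coe] at this
  have hup : ∀ θ, h θ ≤ M := fun θ => key θ M (by linarith) (hM _ (hin θ))
  have hint : ∀ x y : ℝ, IntervalIntegrable h volume x y := by
    intro x y
    refine (intervalIntegrable_const (c := max |(m : ℝ)| |M|)).mono_fun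
      hhm.aestronglyMeasurable ?_
    refine Eventually.of_forall fun θ => ?_
    simp only [Real.norm_eq_abs]
    rw [abs_of_nonneg (le_trans (abs_nonneg _) (le_max_left |(m : ℝ)| |M|)), abs_le]
    constructor
    · have := le_max_left |(m : ℝ)| |M|
      have := le_abs_self (m : ℝ)
      linarith [hlow θ]
    · exact (hup θ).trans ((le_abs_self M).trans (le_max_right _ _))
  have e1 : ∫ θ in (0:ℝ)..a, h θ ≤ ∫ θ in (0:ℝ)..a, M :=
    intervalIntegral.integral_mono_on ha (hint _ _) (by simp) fun θ _ => hup θ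
  have e2 : ∫ θ in a..b, h θ ≤ ∫ θ in a..b, c' :=
    intervalIntegral.integral_mono_on hab.le (hint _ _) (by simp)
      fun θ hθ => key θ c' (by linarith) (hc θ hθ)
  have e3 : ∫ θ in b..(2 * Real.pi), h θ ≤ ∫ θ in b..(2 * Real.pi), M :=
    intervalIntegral.integral_mono_on hb (hint _ _) (by simp) fun θ _ => hup θ
  have e4 : ∫ θ in (0:ℝ)..(2 * Real.pi), h θ = (∫ θ in (0:ℝ)..a, h θ) + (∫ θ in a..b, h θ) +
      ∫ θ in b..(2 * Real.pi), h θ := by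
    rw [intervalIntegral.integral_add_adjacent_intervals (hint _ _) (hint _ _),
      intervalIntegral.integral_add_adjacent_intervals (hint _ _) (hint _ _)]
  simp only [intervalIntegral.integral_const, smul_eq_mul] at e1 e2 e3
  have e5 : ∫ θ in (0:ℝ)..(2 * Real.pi), h θ ≤ 2 * Real.pi * M - (M - c') * (b - a) := by
    rw [e4]; nlinarith
  calc (2 * Real.pi)⁻¹ * ∫ θ in (0:ℝ)..(2 * Real.pi), h θ
      ≤ (2 * Real.pi)⁻¹ * (2 * Real.pi * M - (M - c') * (b - a)) := by gcongr
    _ = _ := by field_simp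

/-- Maximum principle on a disc. -/
lemma max_principle {f : ℂ → EReal} {U : Set ℂ} (hf : SubharmonicOn f U) {R : ℝ}
    (hR : 0 < R) (hU : Metric.closedBall 0 R ⊆ U) {C : ℝ}
    (htop : ∀ ζ ∈ Metric.closedBall (0 : ℂ) R, f ζ ≠ ⊤)
    (hC : ∀ ζ ∈ Metric.sphere (0 : ℂ) R, f ζ ≤ (C : EReal)) :
    ∀ ζ ∈ Metric.closedBall (0 : ℂ) R, f ζ ≤ (C : EReal) := by
  by_contra! hcon
  obtain ⟨ζ₀, hζ₀, hlt⟩ := hcon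
  have hKc : IsCompact (Metric.closedBall (0 : ℂ) R) := isCompact_closedBall _ _
  have husc : UpperSemicontinuousOn f (Metric.closedBall 0 R) := hf.1.mono hU
  obtain ⟨p₀, hp₀, hmax⟩ := husc.exists_isMaxOn ⟨ζ₀, hζ₀⟩ hKc
  have hmax' : ∀ ζ ∈ Metric.closedBall (0 : ℂ) R, f ζ ≤ f p₀ := fun ζ h => hmax h
  have hCM : (C : EReal) < f p₀ := hlt.trans_le (hmax' _ hζ₀)
  set M : ℝ := (f p₀).toReal with hMdef
  have hMe : ((M : ℝ) : EReal) = f p₀ :=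
    EReal.coe_toReal (htop _ hp₀) (ne_of_gt ((EReal.bot_lt_coe C).trans hCM))
  rw [← hMe] at hCM hmax'
  set F : Set ℂ := Metric.closedBall 0 R ∩ f ⁻¹' Set.Ici (M : EReal) with hF
  have hFc : IsCompact F := by
    have : IsClosed F := by
      obtain ⟨v, hv, hv'⟩ := upperSemicontinuousOn_iff_preimage_Ici.1 husc (M : EReal)
      rw [hF, hv']
      exact Metric.isClosed_closedBall.inter hv
    exact hKc.of_isClosed_subset this Set.inter_subset_left
  obtain ⟨p, hpF, hpmax⟩ := hFc.exists_isMaxOn ⟨p₀, hp₀, hMe.le⟩ continuous_norm.continuousOn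
  have hpmax' : ∀ q ∈ F, ‖q‖ ≤ ‖p‖ := fun q h => hpmax h
  have hpR : ‖p‖ < R := by
    have h1 : ‖p‖ ≤ R := by simpa using hpF.1
    refine lt_of_le_of_ne h1 fun h2 => ?_
    have := hC p (by simpa using h2)
    exact absurd (hCM.trans_le hpF.2) (not_lt.2 this)
  set r := (R - ‖p‖) / 2 with hr
  have hr0 : 0 < r := by rw [hr]; linarith
  have hsub : Metric.closedBall p r ⊆ Metric.closedBall 0 R := by
    apply Metric.closedBall_subset_closedBall'
    rw [dist_zero_right, hr]; linarith
  set q : ℂ := p + (r : ℂ) * Complex.exp (p.arg * Complex.I) with hq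
  have hqn : ‖q‖ = ‖p‖ + r := by
    have : q = ((‖p‖ + r : ℝ) : ℂ) * Complex.exp (p.arg * Complex.I) := by
      rw [hq]
      conv_lhs => rw [← Complex.norm_mul_exp_arg_mul_I p]
      simp only [Complex.norm_mul_exp_arg_mul_I]
      conv_lhs => rw [← Complex.norm_mul_exp_arg_mul_I p]
      push_cast
      have : (↑‖p‖ * cexp (↑p.arg * I)).arg = p.arg := by rw [Complex.norm_mul_exp_arg_mul_I]
      rw [this]
      ring
    rw [this, norm_mul, Complex.norm_exp_ofReal_mul_I, mul_one, Complex.norm_real,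
      Real.norm_of_nonneg (by positivity)]
  have hqK : q ∈ Metric.closedBall (0 : ℂ) R := by
    rw [mem_closedBall_zero_iff, hqn, hr]; linarith
  have hqM : f q < (M : EReal) := by
    by_contra! h
    have := hpmax' q ⟨hqK, h⟩
    linarith
  obtain ⟨c', hc1, hc2⟩ := EReal.exists_between_coe_real hqM
  have hev := hf.1 q (hU hqK) _ hc1
  obtain ⟨V, hVo, hqV, hV⟩ := mem_nhdsWithin.1 hev
  obtain ⟨a, b, ha, hab, hb, harc⟩ := exists_arc p r V hVo p.arg hqV
  have hin : ∀ θ : ℝ, p + (r : ℂ) * Complex.exp (θ * Complex.I) ∈ Metric.closedBall p r := by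
    intro θ
    simp [Complex.norm_exp_ofReal_mul_I, abs_of_pos hr0]
  have hc2' : c' < M := EReal.coe_lt_coe_iff.1 hc2
  have hfin := submean_arc hf hr0 (hsub.trans hU) ha hab hb hc2'.le
    (fun ζ hζ => hmax' ζ (hsub hζ))
    (fun θ hθ => le_of_lt (hV ⟨harc θ hθ, hU (hsub (hin θ))⟩))
  have h3 : (M : EReal) ≤ f p := hpF.2
  have h4 := EReal.coe_le_coe_iff.1 (h3.trans hfin)
  have : 0 < (M - c') * (b - a) / (2 * Real.pi) := by
    have := Real.two_pi_pos
    have := sub_pos.2 hc2'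
    have := sub_pos.2 hab
    positivity
  linarith

lemma eq_bot_of_forall_le (x : EReal) (h : ∀ m : ℕ, x ≤ ((-(m : ℝ) : ℝ) : EReal)) : x = ⊥ := by
  rw [EReal.eq_bot_iff_forall_lt]
  intro y
  obtain ⟨m, hm⟩ := exists_nat_gt (-y)
  exact (h m).trans_lt (EReal.coe_lt_coe_iff.2 (by linarith))

section ball
variable {E : Type*} [NormedAddCommGroup E] [NormedSpace ℂ E]

lemma extend_bot {u : E → EReal} (hu : PshOn u (Metric.ball (0 : E) 1))
    (hneg : ∀ z ∈ Metric.ball (0 : E) 1, u z ≤ 0) {ρ : ℝ} (h0 : 0 < ρ) (h1 : ρ < 1)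
    (hbot : ∀ z ∈ Metric.ball (0 : E) ρ, u z = ⊥) :
    ∀ z ∈ Metric.ball (0 : E) ((1 + ρ) / 2), u z = ⊥ := by
  intro z hz
  rw [mem_ball_zero_iff] at hz
  by_cases hzρ : ‖z‖ < ρ
  · exact hbot z (by simpa using hzρ)
  push Not at hzρ
  have hz0 : 0 < ‖z‖ := h0.trans_le hzρ
  set t := min ((1 - ρ) / 2) ‖z‖ with ht
  have ht0 : 0 < t := lt_min (by linarith) hz0
  have ht1 : t ≤ (1 - ρ) / 2 := min_le_left _ _
  have ht2 : t ≤ ‖z‖ := min_le_right _ _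
  have ht3 : ‖z‖ - t < ρ := by
    rcases min_choice ((1 - ρ) / 2) ‖z‖ with h | h <;> rw [ht, h] <;> linarith
  set s := t / ‖z‖ with hs
  have hs0 : 0 < s := by positivity
  have hsz : s * ‖z‖ = t := by rw [hs]; field_simp
  have hf := hu.2.2 z z
  have hU : Metric.closedBall (0 : ℂ) s ⊆ {ζ : ℂ | z + ζ • z ∈ Metric.ball (0 : E) 1} := by
    intro ζ hζ
    rw [mem_closedBall_zero_iff] at hζ
    simp only [Set.mem_ofPred_eq, mem_ball_zero_iff]
    calc ‖z + ζ • z‖ ≤ ‖z‖ + ‖ζ‖ * ‖z‖ := by rw [← norm_smul]; exact norm_add_le _ _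
      _ ≤ ‖z‖ + s * ‖z‖ := by gcongr
      _ < 1 := by rw [hsz]; linarith
  have hVo : IsOpen {ζ : ℂ | z + ζ • z ∈ Metric.ball (0 : E) ρ} :=
    Metric.isOpen_ball.preimage (by fun_prop)
  obtain ⟨a, b, ha, hab, hb, harc⟩ := exists_arc 0 s _ hVo Real.pi (by
    simp only [Set.mem_ofPred_eq, mem_ball_zero_iff, Complex.exp_pi_mul_I, zero_add]
    have : z + ((s : ℂ) * -1) • z = ((1 - s : ℝ) : ℂ) • z := by
      push_cast
      module
    rw [this, norm_smul, Complex.norm_real, Real.norm_of_nonneg]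
    · linarith [sub_mul 1 s ‖z‖]
    · rw [sub_nonneg, hs, div_le_one hz0]; exact ht2)
  set κ := (b - a) / (2 * Real.pi) with hκ
  have hκ0 : 0 < κ := div_pos (sub_pos.2 hab) Real.two_pi_pos
  have main : ∀ m : ℕ, u z ≤ ((-(m * κ) : ℝ) : EReal) := by
    intro m
    have := submean_arc (M := 0) (c' := -(m : ℝ)) hf hs0 hU ha hab hb (by simp)
      (fun ζ hζ => by simpa using hneg _ (hU hζ))
      (fun θ hθ => by rw [hbot _ (harc θ hθ)]; exact bot_le)
    simp only [zero_smul, add_zero] at this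
    convert this using 2
    rw [hκ]; ring
  apply eq_bot_of_forall_le
  intro m
  obtain ⟨k, hk⟩ := exists_nat_ge ((m : ℝ) / κ)
  refine (main k).trans (EReal.coe_le_coe_iff.2 ?_)
  rw [div_le_iff₀ hκ0] at hk
  linarith

lemma extend_bot_ball {u : E → EReal} (hu : PshOn u (Metric.ball (0 : E) 1))
    (hneg : ∀ z ∈ Metric.ball (0 : E) 1, u z ≤ 0) {ρ : ℝ} (h0 : 0 < ρ) (h1 : ρ < 1)
    (hbot : ∀ z ∈ Metric.ball (0 : E) ρ, u z = ⊥) :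
    ∀ z ∈ Metric.ball (0 : E) 1, u z = ⊥ := by
  have step : ∀ n : ℕ, ∀ z ∈ Metric.ball (0 : E) (1 - (1 - ρ) * (1 / 2) ^ n), u z = ⊥ := by
    intro n
    induction n with
    | zero => simpa using hbot
    | succ n ih =>
      have hp : (0 : ℝ) < (1 / 2) ^ n := by positivity
      have hp1 : ((1 : ℝ) / 2) ^ n ≤ 1 := pow_le_one₀ (by norm_num) (by norm_num)
      have := extend_bot hu hneg (by nlinarith) (by nlinarith) ih
      convert this using 3
      rw [pow_succ]; ring
  intro z hz
  rw [mem_ball_zero_iff] at hz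
  obtain ⟨n, hn⟩ := exists_pow_lt_of_lt_one (sub_pos.2 hz) (show (1 / 2 : ℝ) < 1 by norm_num)
  apply step n
  rw [mem_ball_zero_iff]
  have hp : (0 : ℝ) < (1 / 2) ^ n := by positivity
  nlinarith

end ball

abbrev E2 := EuclideanSpace ℂ (Fin 2)

def torus (α : ℝ) : Set E2 := {p : EuclideanSpace ℂ (Fin 2) | ∃ φ ψ : ℝ,
          p 0 = Complex.exp (φ * Complex.I) * (Real.cos α : ℂ) ∧
          p 1 = Complex.exp (ψ * Complex.I) * (Real.sin α : ℂ)}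

lemma normsq_E2 (p : E2) : ‖p‖ ^ 2 = ‖p 0‖ ^ 2 + ‖p 1‖ ^ 2 := by
  rw [EuclideanSpace.norm_sq_eq, Fin.sum_univ_two]

lemma mem_torus (α : ℝ) (hα₀ : 0 < α) (hα₁ : α < Real.pi / 2) (p : E2) :
    p ∈ torus α ↔ ‖p 0‖ = Real.cos α ∧ ‖p 1‖ = Real.sin α := by
  have hc : 0 < Real.cos α := Real.cos_pos_of_mem_Ioo ⟨by linarith, hα₁⟩
  have hs : 0 < Real.sin α := Real.sin_pos_of_pos_of_lt_pi hα₀ (by linarith [Real.pi_pos])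
  constructor
  · rintro ⟨φ, ψ, h0, h1⟩
    rw [h0, h1, norm_mul, norm_mul, Complex.norm_exp_ofReal_mul_I, Complex.norm_exp_ofReal_mul_I,
      Complex.norm_real, Complex.norm_real, Real.norm_of_nonneg hc.le, Real.norm_of_nonneg hs.le]
    simp
  · rintro ⟨h0, h1⟩
    refine ⟨(p 0).arg, (p 1).arg, ?_, ?_⟩
    · rw [← h0, mul_comm, Complex.norm_mul_exp_arg_mul_I]
    · rw [← h1, mul_comm, Complex.norm_mul_exp_arg_mul_I]

lemma torus_compact (α : ℝ) (hα₀ : 0 < α) (hα₁ : α < Real.pi / 2) : IsCompact (torus α) := by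
  have hEq : torus α = {p : E2 | ‖p 0‖ = Real.cos α} ∩ {p : E2 | ‖p 1‖ = Real.sin α} := by
    ext p; exact mem_torus α hα₀ hα₁ p
  have hcl : IsClosed (torus α) := by
    rw [hEq]
    exact (isClosed_eq (by fun_prop) (by fun_prop)).inter (isClosed_eq (by fun_prop) (by fun_prop))
  refine (isCompact_closedBall (0 : E2) 1).of_isClosed_subset hcl ?_
  intro p hp
  rw [mem_torus α hα₀ hα₁] at hp
  have := normsq_E2 p
  rw [hp.1, hp.2, Real.cos_sq_add_sin_sq] at this
  rw [mem_closedBall_zero_iff]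
  nlinarith [norm_nonneg p]

lemma small_bot (α : ℝ) (hα₀ : 0 < α) (hα₁ : α < Real.pi / 2) {u : E2 → EReal}
    (hu : PshOn u (Metric.ball (0 : E2) 1))
    (hA : ∀ x ∈ torus α, uscReg u (Metric.ball (0 : E2) 1) x = ⊥) :
    ∀ z : E2, ‖z 0‖ ≤ Real.cos α / 2 → ‖z 1‖ ≤ Real.sin α / 2 → u z = ⊥ := by
  have hc : 0 < Real.cos α := Real.cos_pos_of_mem_Ioo ⟨by linarith, hα₁⟩
  have hs : 0 < Real.sin α := Real.sin_pos_of_pos_of_lt_pi hα₀ (by linarith [Real.pi_pos])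
  intro z hz0 hz1
  apply eq_bot_of_forall_le
  intro m
  have h1 : ∀ x ∈ torus α, ∀ᶠ y in 𝓝 x, y ∈ Metric.ball (0 : E2) 1 →
      u y < ((-(m : ℝ) : ℝ) : EReal) := by
    intro x hx
    have := hA x hx
    unfold uscReg at this
    have h2 : Filter.limsup u (𝓝[Metric.ball (0 : E2) 1] x) < ((-(m : ℝ) : ℝ) : EReal) := by
      rw [this]; exact EReal.bot_lt_coe _
    exact eventually_nhdsWithin_iff.1 (eventually_lt_of_limsup_lt h2)
  have h2 : ∀ᶠ r : ℝ in 𝓝 1, ∀ x ∈ torus α, ((r : ℂ) • x) ∈ Metric.ball (0 : E2) 1 →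
      u ((r : ℂ) • x) < ((-(m : ℝ) : ℝ) : EReal) := by
    refine (torus_compact α hα₀ hα₁).eventually_forall_of_forall_eventually ?_
    intro x hx
    have hcont : Continuous fun q : ℝ × E2 => ((q.1 : ℂ) • q.2) := by fun_prop
    have ht := hcont.tendsto (1, x)
    simp only [Complex.ofReal_one, one_smul] at ht
    exact ht.eventually (h1 x hx)
  have h3 : ∃ r : ℝ, 1 / 2 < r ∧ r < 1 ∧ ∀ x ∈ torus α, ((r : ℂ) • x) ∈ Metric.ball (0 : E2) 1 →
      u ((r : ℂ) • x) < ((-(m : ℝ) : ℝ) : EReal) := by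
    have h4 : ∀ᶠ r : ℝ in 𝓝[<] 1, r ∈ Set.Ioo (1 / 2 : ℝ) 1 :=
      Ioo_mem_nhdsLT (by norm_num)
    obtain ⟨r, hr, hr'⟩ := (h4.and (h2.filter_mono nhdsWithin_le_nhds)).exists
    exact ⟨r, hr.1, hr.2, hr'⟩
  obtain ⟨r, hr1, hr2, hr⟩ := h3
  have hr0 : 0 < r := by linarith
  have hball : ∀ a b : ℂ, ‖a‖ ≤ r * Real.cos α → ‖b‖ ≤ r * Real.sin α →
      (!₂[a, b] : E2) ∈ Metric.ball (0 : E2) 1 := by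
    intro a b ha hb
    rw [mem_ball_zero_iff]
    have := normsq_E2 !₂[a, b]
    simp only [Matrix.cons_val_zero, Matrix.cons_val_one] at this
    have ha2 : ‖a‖ ^ 2 ≤ (r * Real.cos α) ^ 2 := by gcongr
    have hb2 : ‖b‖ ^ 2 ≤ (r * Real.sin α) ^ 2 := by gcongr
    have hr3 : r ^ 2 < 1 := by nlinarith
    have hcs := Real.cos_sq_add_sin_sq α
    have h5 : ‖(!₂[a, b] : E2)‖ ^ 2 < 1 := by
      rw [this]
      calc _ ≤ (r * Real.cos α) ^ 2 + (r * Real.sin α) ^ 2 := add_le_add ha2 hb2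
        _ = r ^ 2 * (Real.cos α ^ 2 + Real.sin α ^ 2) := by ring
        _ < 1 := by rw [hcs]; linarith
    nlinarith [norm_nonneg (!₂[a, b] : E2)]
  have hT : ∀ a b : ℂ, ‖a‖ = r * Real.cos α → ‖b‖ = r * Real.sin α →
      u !₂[a, b] ≤ ((-(m : ℝ) : ℝ) : EReal) := by
    intro a b ha hb
    have hrc : (r : ℂ) ≠ 0 := by exact_mod_cast hr0.ne'
    have hx : ((r : ℂ) • (!₂[a / r, b / r] : E2)) = !₂[a, b] := by
      ext i
      fin_cases i <;> simp <;> field_simp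
    have := hr !₂[a / r, b / r] (by
      rw [mem_torus α hα₀ hα₁]
      simp only [Matrix.cons_val_zero, Matrix.cons_val_one, norm_div, ha, hb, Complex.norm_real,
        Real.norm_of_nonneg hr0.le]
      constructor <;> field_simp) (by rw [hx]; exact hball a b ha.le hb.le)
    rw [hx] at this
    exact this.le
  have hS1 : ∀ a b : ℂ, ‖a‖ = r * Real.cos α → ‖b‖ ≤ r * Real.sin α →
      u !₂[a, b] ≤ ((-(m : ℝ) : ℝ) : EReal) := by
    intro a b ha hb
    have hf := hu.2.2 !₂[a, 0] !₂[0, 1]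
    have hid : ∀ ζ : ℂ, (!₂[a, 0] : E2) + ζ • !₂[0, 1] = !₂[a, ζ] := by
      intro ζ; ext i; fin_cases i <;> simp
    simp only [hid] at hf
    refine max_principle hf (R := r * Real.sin α) (by positivity) ?_ ?_ ?_ b (by simpa using hb)
    · intro ζ hζ
      exact hball a ζ ha.le (by simpa using hζ)
    · intro ζ hζ
      exact hu.2.1 _ (hball a ζ ha.le (by simpa using hζ))
    · intro ζ hζ
      exact hT a ζ ha (by simpa using hζ)
  have hS2 : ∀ a b : ℂ, ‖a‖ ≤ r * Real.cos α → ‖b‖ ≤ r * Real.sin α →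
      u !₂[a, b] ≤ ((-(m : ℝ) : ℝ) : EReal) := by
    intro a b ha hb
    have hf := hu.2.2 !₂[0, b] !₂[1, 0]
    have hid : ∀ ζ : ℂ, (!₂[0, b] : E2) + ζ • !₂[1, 0] = !₂[ζ, b] := by
      intro ζ; ext i; fin_cases i <;> simp
    simp only [hid] at hf
    refine max_principle hf (R := r * Real.cos α) (by positivity) ?_ ?_ ?_ a (by simpa using ha)
    · intro ζ hζ
      exact hball ζ b (by simpa using hζ) hb
    · intro ζ hζ
      exact hu.2.1 _ (hball ζ b (by simpa using hζ) hb)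
    · intro ζ hζ
      exact hS1 ζ b (by simpa using hζ) hb
  have hz : z = !₂[z 0, z 1] := by ext i; fin_cases i <;> simp
  rw [hz]
  apply hS2
  · nlinarith
  · nlinarith

lemma part_one (α : ℝ) (hα₀ : 0 < α) (hα₁ : α < Real.pi / 2) {u : E2 → EReal}
    (hu : PshOn u (Metric.ball (0 : E2) 1))
    (hneg : ∀ z ∈ Metric.ball (0 : E2) 1, u z ≤ 0)
    (hA : ∀ x ∈ torus α, uscReg u (Metric.ball (0 : E2) 1) x = ⊥) :
    ∀ z ∈ Metric.ball (0 : E2) 1, u z = ⊥ := by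
  have hc : 0 < Real.cos α := Real.cos_pos_of_mem_Ioo ⟨by linarith, hα₁⟩
  have hs : 0 < Real.sin α := Real.sin_pos_of_pos_of_lt_pi hα₀ (by linarith [Real.pi_pos])
  have hc1 := Real.cos_le_one α
  refine extend_bot_ball hu hneg (ρ := min (Real.cos α / 2) (Real.sin α / 2))
    (by positivity) (lt_of_le_of_lt (min_le_left _ _) (by linarith)) ?_
  intro z hz
  rw [mem_ball_zero_iff, lt_min_iff] at hz
  exact small_bot α hα₀ hα₁ hu hA z ((PiLp.norm_apply_le z 0).trans hz.1.le)
    ((PiLp.norm_apply_le z 1).trans hz.2.le)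

/-- Real parts of complex affine functionals are plurisubharmonic. -/
lemma psh_affine (k : ℝ) (y : E2) (D : Set E2) :
    PshOn (fun z : E2 => ((k * ((inner ℂ y z).re - 1) : ℝ) : EReal)) D := by
  have hcont : Continuous fun z : E2 => ((k * ((inner ℂ y z).re - 1) : ℝ) : EReal) := by
    refine continuous_coe_real_ereal.comp ?_
    have : Continuous fun z : E2 => inner ℂ y z := by fun_prop
    fun_prop
  refine ⟨hcont.upperSemicontinuous.upperSemicontinuousOn _, fun _ _ => EReal.coe_ne_top _, ?_⟩
  intro a b
  have hcont2 : Continuous fun ζ : ℂ => a + ζ • b := by fun_prop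
  refine ⟨(hcont.comp hcont2).upperSemicontinuous.upperSemicontinuousOn _, ?_⟩
  intro c r hr _ m
  rw [EReal.coe_le_coe_iff]
  unfold truncCircleAvg
  set β : ℂ := inner ℂ y b with hβ
  set K : ℝ := k * ((inner ℂ y (a + c • b)).re - 1) with hK
  have hval : ∀ θ : ℝ, (k * ((inner ℂ y (a + (c + (r : ℂ) * Complex.exp (θ * Complex.I)) • b)).re
      - 1)) = K + (k * r * β.re) * Real.cos θ - (k * r * β.im) * Real.sin θ := by
    intro θ
    rw [hK]
    simp only [inner_add_right, inner_smul_right, ← hβ, add_mul, Complex.add_re, Complex.mul_re,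
      Complex.ofReal_re, Complex.ofReal_im, Complex.exp_ofReal_mul_I_re,
      Complex.exp_ofReal_mul_I_im, Complex.mul_im]
    ring
  simp only [hval]
  have hpi := Real.two_pi_pos
  have hmax : ∀ t : ℝ, (max ((t : ℝ) : EReal) ((-(m : ℝ) : ℝ) : EReal)).toReal = max t (-m) := by
    intro t
    rw [← EReal.coe_strictMono.monotone.map_max, EReal.toReal_coe]
  simp only [hmax]
  have hle : ∫ θ in (0:ℝ)..(2 * Real.pi),
      (K + (k * r * β.re) * Real.cos θ - (k * r * β.im) * Real.sin θ) ≤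
      ∫ θ in (0:ℝ)..(2 * Real.pi),
      max (K + (k * r * β.re) * Real.cos θ - (k * r * β.im) * Real.sin θ) (-(m : ℝ)) := by
    apply intervalIntegral.integral_mono_on hpi.le
    · exact Continuous.intervalIntegrable (by fun_prop) _ _
    · exact Continuous.intervalIntegrable (by fun_prop) _ _
    · intro θ _; exact le_max_left _ _
  have heq : ∫ θ in (0:ℝ)..(2 * Real.pi),
      (K + (k * r * β.re) * Real.cos θ - (k * r * β.im) * Real.sin θ) = 2 * Real.pi * K := by
    rw [intervalIntegral.integral_sub (Continuous.intervalIntegrable (by fun_prop) _ _)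
      (Continuous.intervalIntegrable (by fun_prop) _ _),
      intervalIntegral.integral_add (Continuous.intervalIntegrable (by fun_prop) _ _)
      (Continuous.intervalIntegrable (by fun_prop) _ _)]
    simp
  rw [heq] at hle
  calc K = (2 * Real.pi)⁻¹ * (2 * Real.pi * K) := by field_simp
    _ ≤ _ := by gcongr

/-- Lower bound for the extremal function along the radius at a point off the torus. -/
lemma bndExt_lower (α : ℝ) (hα₀ : 0 < α) (hα₁ : α < Real.pi / 2) (y : E2) (hy : ‖y‖ = 1)
    (hyA : ‖y 0‖ ≠ Real.cos α) : ∃ k : ℝ, 0 < k ∧ ∀ t : ℝ,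
      ((k * (t - 1) : ℝ) : EReal) ≤ bndExt ((t : ℂ) • y) (torus α) (Metric.ball (0 : E2) 1) := by
  set d : ℝ := (Real.cos α - ‖y 0‖) ^ 2 / 2 with hd
  have hd0 : 0 < d := by
    have : Real.cos α - ‖y 0‖ ≠ 0 := sub_ne_zero.2 hyA.symm
    positivity
  have hin : ∀ p ∈ torus α, (inner ℂ y p).re ≤ 1 - d := by
    intro p hp
    rw [mem_torus α hα₀ hα₁] at hp
    have h1 : inner ℂ y p = inner ℂ (y 0) (p 0) + inner ℂ (y 1) (p 1) := by
      rw [PiLp.inner_apply, Fin.sum_univ_two]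
    have h2 : (inner ℂ (y 0) (p 0)).re ≤ ‖y 0‖ * ‖p 0‖ :=
      (Complex.re_le_norm _).trans (norm_inner_le_norm _ _)
    have h3 : (inner ℂ (y 1) (p 1)).re ≤ ‖y 1‖ * ‖p 1‖ :=
      (Complex.re_le_norm _).trans (norm_inner_le_norm _ _)
    have h4 := normsq_E2 y
    rw [hy] at h4
    rw [h1, Complex.add_re]
    rw [hp.1] at h2
    rw [hp.2] at h3
    have := Real.cos_sq_add_sin_sq α
    rw [hd]
    nlinarith [sq_nonneg (Real.sin α - ‖y 1‖)]
  refine ⟨2 / d, by positivity, fun t => ?_⟩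
  apply le_sSup
  refine ⟨fun z : E2 => ((2 / d * ((inner ℂ y z).re - 1) : ℝ) : EReal),
    ⟨psh_affine _ _ _, 0, by simp, EReal.coe_ne_bot _⟩, ?_, ?_, ?_⟩
  · intro z hz
    rw [mem_ball_zero_iff] at hz
    have h1 : (inner ℂ y z).re ≤ 1 := by
      refine (Complex.re_le_norm _).trans ((norm_inner_le_norm _ _).trans ?_)
      rw [hy]; linarith
    have h2 : 0 < 2 / d := by positivity
    have h3 : 2 / d * ((inner ℂ y z).re - 1) ≤ 0 := by nlinarith
    exact EReal.coe_nonpos.2 h3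
  · intro x hx
    unfold uscReg
    apply limsup_le_of_le
    · isBoundedDefault
    · have hcont : Continuous fun z : E2 => 2 / d * ((inner ℂ y z).re - 1) := by
        have : Continuous fun z : E2 => inner ℂ y z := by fun_prop
        fun_prop
      have hval : 2 / d * ((inner ℂ y x).re - 1) < -1 := by
        have h5 := hin x hx
        have h6 : 2 / d * ((inner ℂ y x).re - 1) ≤ 2 / d * (-d) := by
          gcongr; linarith
        have h7 : 2 / d * (-d) = -2 := by field_simp
        linarith
      have hev := (hcont.tendsto x).eventually (gt_mem_nhds hval)
      filter_upwards [hev.filter_mono nhdsWithin_le_nhds] with z hz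
      have h8 : (((-1 : ℝ)) : EReal) = -1 := by simp
      rw [← h8]
      exact EReal.coe_le_coe_iff.2 hz.le
  · have : (inner ℂ y ((t : ℂ) • y)).re = t := by
      rw [inner_smul_right, inner_self_eq_norm_sq_to_K, hy]
      simp
    simp only [this]

/-- Points of the sphere off the torus are dense. -/
lemma dense_off (α : ℝ) (hα₀ : 0 < α) (hα₁ : α < Real.pi / 2) (x : E2) (hx : ‖x‖ = 1)
    (W : Set E2) (hW : W ∈ 𝓝 x) :
    ∃ y ∈ interior W, ‖y‖ = 1 ∧ ‖y 0‖ ≠ Real.cos α := by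
  by_cases h : ‖x 0‖ = Real.cos α
  swap
  · exact ⟨x, mem_interior_iff_mem_nhds.2 hW, hx, h⟩
  have hs : 0 < Real.sin α := Real.sin_pos_of_pos_of_lt_pi hα₀ (by linarith [Real.pi_pos])
  have hxs := normsq_E2 x
  have h1 : ‖x 1‖ = Real.sin α := by
    rw [hx, h] at hxs
    have := Real.cos_sq_add_sin_sq α
    have h2 : ‖x 1‖ ^ 2 = Real.sin α ^ 2 := by linarith
    exact (pow_left_inj₀ (norm_nonneg _) hs.le two_ne_zero).1 h2
  set γ : ℝ → E2 := fun β => !₂[(Real.cos β : ℂ) * Complex.exp ((x 0).arg * Complex.I),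
    (Real.sin β : ℂ) * Complex.exp ((x 1).arg * Complex.I)] with hγ
  have hγc : Continuous γ := by
    apply (PiLp.continuous_toLp 2 _).comp
    apply continuous_pi
    intro i
    fin_cases i
    · simp only [Fin.zero_eta, Matrix.cons_val_zero]; fun_prop
    · simp only [Fin.mk_one, Matrix.cons_val_one, Matrix.cons_val_zero]; fun_prop
  have hγα : γ α = x := by
    ext i
    fin_cases i
    · simp only [hγ, Fin.zero_eta, Matrix.cons_val_zero]
      rw [← h, Complex.norm_mul_exp_arg_mul_I]
    · simp only [hγ, Fin.mk_one, Matrix.cons_val_one, Matrix.cons_val_zero]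
      rw [← h1, Complex.norm_mul_exp_arg_mul_I]
  have hn0 : ∀ β, ‖γ β 0‖ = |Real.cos β| := by
    intro β
    simp only [hγ, Matrix.cons_val_zero]
    rw [norm_mul, Complex.norm_exp_ofReal_mul_I, Complex.norm_real, mul_one, Real.norm_eq_abs]
  have hn1 : ∀ β, ‖γ β 1‖ = |Real.sin β| := by
    intro β
    simp only [hγ, Matrix.cons_val_one, Matrix.cons_val_zero]
    rw [norm_mul, Complex.norm_exp_ofReal_mul_I, Complex.norm_real, mul_one, Real.norm_eq_abs]
  have h3 : ∀ᶠ β in 𝓝 α, γ β ∈ interior W := by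
    apply hγc.continuousAt
    rw [hγα]; exact interior_mem_nhds.2 hW
  have h4 : ∀ᶠ β : ℝ in 𝓝[>] α, β ∈ Set.Ioo α (Real.pi / 2) := Ioo_mem_nhdsGT hα₁
  obtain ⟨β, hβ, hβ'⟩ := (h4.and (h3.filter_mono nhdsWithin_le_nhds)).exists
  refine ⟨γ β, hβ', ?_, ?_⟩
  · have := normsq_E2 (γ β)
    rw [hn0, hn1, sq_abs, sq_abs, Real.cos_sq_add_sin_sq] at this
    nlinarith [norm_nonneg (γ β)]
  · rw [hn0, abs_of_pos (Real.cos_pos_of_mem_Ioo ⟨by linarith [hβ.1], hβ.2⟩)]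
    exact (Real.cos_lt_cos_of_nonneg_of_le_pi_div_two hα₀.le hβ.2.le hβ.1).ne

lemma part_three (α : ℝ) (hα₀ : 0 < α) (hα₁ : α < Real.pi / 2) (x : E2) (hx : ‖x‖ = 1) :
    bndExtStar x (torus α) (Metric.ball (0 : E2) 1) = 0 := by
  unfold bndExtStar
  apply le_antisymm
  · apply limsup_le_of_le
    · isBoundedDefault
    · filter_upwards [self_mem_nhdsWithin] with z hz
      apply sSup_le
      rintro w ⟨u, _, hneg, _, rfl⟩
      exact hneg z hz
  · have main : ∀ n : ℕ, ((-(1 / ((n : ℝ) + 1)) : ℝ) : EReal) ≤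
        Filter.limsup (fun z => bndExt z (torus α) (Metric.ball (0 : E2) 1))
          (𝓝[Metric.ball (0 : E2) 1] x) := by
      intro n
      apply le_limsup_of_frequently_le
      swap
      · isBoundedDefault
      rw [Filter.Frequently, eventually_nhdsWithin_iff]
      intro hcon
      set W : Set E2 := {z : E2 | z ∈ Metric.ball (0 : E2) 1 → ¬ ((-(1 / ((n : ℝ) + 1)) : ℝ) : EReal)
        ≤ bndExt z (torus α) (Metric.ball (0 : E2) 1)} with hWdef
      obtain ⟨y, hyW, hy1, hyA⟩ := dense_off α hα₀ hα₁ x hx W hcon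
      obtain ⟨k, hk, hlow⟩ := bndExt_lower α hα₀ hα₁ y hy1 hyA
      have hcont : Continuous fun t : ℝ => (t : ℂ) • y := by fun_prop
      have h1 : ∀ᶠ t : ℝ in 𝓝 1, (t : ℂ) • y ∈ interior W := by
        apply hcont.continuousAt
        simp only [Complex.ofReal_one, one_smul]
        exact isOpen_interior.mem_nhds hyW
      have h2 : ∀ᶠ t : ℝ in 𝓝 1, -(1 / ((n : ℝ) + 1)) < k * (t - 1) := by
        have : Continuous fun t : ℝ => k * (t - 1) := by fun_prop
        apply this.continuousAt.eventually (lt_mem_nhds _)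
        simp only [sub_self, mul_zero]
        have : 0 < 1 / ((n : ℝ) + 1) := by positivity
        linarith
      have h4 : ∀ᶠ t : ℝ in 𝓝[<] 1, t ∈ Set.Ioo (0 : ℝ) 1 := Ioo_mem_nhdsLT (by norm_num)
      obtain ⟨t, ht, ht'⟩ := (h4.and ((h1.and h2).filter_mono nhdsWithin_le_nhds)).exists
      have h5 := interior_subset ht'.1
      refine h5 ?_ ?_
      · rw [mem_ball_zero_iff, norm_smul, hy1, mul_one, Complex.norm_real,
          Real.norm_of_nonneg ht.1.le]
        exact ht.2
      · exact (EReal.coe_le_coe_iff.2 ht'.2.le).trans (hlow t)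
    have hlim : Tendsto (fun n : ℕ => ((-(1 / ((n : ℝ) + 1)) : ℝ) : EReal)) atTop (𝓝 0) := by
      have h := (tendsto_one_div_add_atTop_nhds_zero_nat (𝕜 := ℝ)).neg
      rw [neg_zero] at h
      exact (continuous_coe_real_ereal.tendsto 0).comp h
    exact le_of_tendsto' hlim main

/-- For `0 < α < π/2`, let `A_α ⊆ ∂𝔹` be the distinguished boundary
`{(e^{iφ} cos α, e^{iψ} sin α)}` of the polydisc `Δ_α`.  Every `u ∈ PSH(𝔹)` with `u ≤ 0`
and `u* = -∞` on `A_α` is identically `-∞`; in particular `A_α` is not b-pluripolar.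
Nevertheless `ω*(·, A_α, 𝔹) = 0` on `∂𝔹`. -/
theorem distinguished_boundary_not_bPluripolar
    (α : ℝ) (hα₀ : 0 < α) (hα₁ : α < Real.pi / 2) :
    (∀ u : EuclideanSpace ℂ (Fin 2) → EReal,
      PshOn u (Metric.ball (0 : EuclideanSpace ℂ (Fin 2)) 1) →
      (∀ z ∈ Metric.ball (0 : EuclideanSpace ℂ (Fin 2)) 1, u z ≤ 0) →
      (∀ x ∈ {p : EuclideanSpace ℂ (Fin 2) | ∃ φ ψ : ℝ,
          p 0 = Complex.exp (φ * Complex.I) * (Real.cos α : ℂ) ∧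
          p 1 = Complex.exp (ψ * Complex.I) * (Real.sin α : ℂ)},
        uscReg u (Metric.ball (0 : EuclideanSpace ℂ (Fin 2)) 1) x = ⊥) →
      ∀ z ∈ Metric.ball (0 : EuclideanSpace ℂ (Fin 2)) 1, u z = ⊥) ∧
    ¬ BPluripolar
      {p : EuclideanSpace ℂ (Fin 2) | ∃ φ ψ : ℝ,
          p 0 = Complex.exp (φ * Complex.I) * (Real.cos α : ℂ) ∧
          p 1 = Complex.exp (ψ * Complex.I) * (Real.sin α : ℂ)}
      (Metric.ball (0 : EuclideanSpace ℂ (Fin 2)) 1) ∧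
    ∀ x ∈ Metric.sphere (0 : EuclideanSpace ℂ (Fin 2)) 1,
      bndExtStar x
        {p : EuclideanSpace ℂ (Fin 2) | ∃ φ ψ : ℝ,
          p 0 = Complex.exp (φ * Complex.I) * (Real.cos α : ℂ) ∧
          p 1 = Complex.exp (ψ * Complex.I) * (Real.sin α : ℂ)}
        (Metric.ball (0 : EuclideanSpace ℂ (Fin 2)) 1) = 0 := by
  refine ⟨?_, ?_, ?_⟩
  · intro u hu hneg hA
    exact part_one α hα₀ hα₁ hu hneg hA
  · rintro ⟨u, hu, hneg, ⟨z, hz, hz'⟩, hA⟩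
    exact hz' (part_one α hα₀ hα₁ hu hneg hA z hz)
  · intro x hx
    exact part_three α hα₀ hα₁ x (by simpa using hx)
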